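/- Let (R, m) be a commutative noetherian local ring and Λ a module-finite R-algebra. Then the global dimension of the m-adic completion R̂ ⊗_R Λ is at most the global dimension of Λ. -/

import Mathlib

section GlobalDimension

open Function

/-- `ProjDimLE A n M` says that the `A`-module `M` admits a projective resolution of
length at most `n`. -/
inductive ProjDimLE (A : Type) [Ring A] : ℕ → ModuleCat.{0} A → Prop
  | proj (M : ModuleCat.{0} A) (h : Module.Projective A M) : ProjDimLE A 0 M
  | step (n : ℕ) (M P : ModuleCat.{0} A) (hP : Module.Projective A P)
      (f : P →ₗ[A] M) (hf : Surjective f)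
      (h : ProjDimLE A n (ModuleCat.of A (LinearMap.ker f))) : ProjDimLE A (n + 1) M

/-- A ring has finite global dimension if there is a uniform finite bound on the
projective dimension of all (left) modules. -/
def HasFiniteGlobalDim (A : Type) [Ring A] : Prop :=
  ∃ n : ℕ, ∀ M : ModuleCat.{0} A, ProjDimLE A n M

end GlobalDimension

section AdicCompletion

/-- A surjection `φ : S → R` carrying a finitely generated ideal `J` to `I` induces a surjection
between the adic completions, so noetherianity of the completion descends along `φ`. -/
theorem AdicCompletion.isNoetherianRing_of_map_eq {S R : Type*} [CommRing S] [CommRing R]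
    {J : Ideal S} {I : Ideal R} (hJ : J.FG) (φ : S →+* R) (hφ : Function.Surjective φ)
    (hI : J.map φ = I) [IsNoetherianRing (AdicCompletion J S)] :
    IsNoetherianRing (AdicCompletion I R) := by
  have hIfg : I.FG := hI ▸ hJ.map φ
  have hn (n : ℕ) : J ^ n ≤ (I ^ n).comap φ := by
    rw [← Ideal.map_le_iff_le_comap, Ideal.map_pow, hI]
  have hf {m n : ℕ} (hle : m ≤ n) : (Ideal.Quotient.factorPow I hle).comp
      ((Ideal.quotientMap (I ^ n) φ (hn n)).comp
        (AdicCompletion.evalₐ J n : AdicCompletion J S →+* S ⧸ J ^ n)) =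
      (Ideal.quotientMap (I ^ m) φ (hn m)).comp
        (AdicCompletion.evalₐ J m : AdicCompletion J S →+* S ⧸ J ^ m) := by
    ext x
    obtain ⟨x, rfl⟩ := AdicCompletion.mk_surjective J S x
    simp only [RingHom.comp_apply, RingHom.coe_coe, AdicCompletion.evalₐ_mk,
      Ideal.quotientMap_mk, Ideal.Quotient.factor_mk]
    rw [← Ideal.quotientMap_mk (H := hn m), ← Ideal.quotientMap_mk (H := hn m),
      AdicCompletion.Ideal.mk_eq_mk J hle]
  let F : AdicCompletion J S →+* AdicCompletion I R := AdicCompletion.liftRingHom I _ hf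
  have hF : F.comp (algebraMap S _) = (algebraMap R _).comp φ := by
    refine RingHom.ext fun x ↦ AdicCompletion.ext_evalₐ fun n ↦ ?_
    simp only [F, RingHom.comp_apply, AdicCompletion.evalₐ_liftRingHom, RingHom.coe_coe,
      AlgHom.commutes]
    simp
  have hmap : (J.map (algebraMap S (AdicCompletion J S))).map F =
      I.map (algebraMap R (AdicCompletion I R)) := by
    rw [Ideal.map_map, hF, ← Ideal.map_map, hI]
  have : IsAdicComplete (J.map (algebraMap S (AdicCompletion J S))) (AdicCompletion J S) :=
    AdicCompletion.isAdicComplete_self J hJ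
  have : IsAdicComplete ((J.map (algebraMap S (AdicCompletion J S))).map F)
      (AdicCompletion I R) := by
    rw [hmap]
    exact AdicCompletion.isAdicComplete_self I hIfg
  refine _root_.isNoetherianRing_of_surjective _ _ F (surjective_of_mk_map_comp_surjective
    (I := J.map (algebraMap S (AdicCompletion J S))) F fun y ↦ ?_)
  obtain ⟨y, rfl⟩ := Ideal.Quotient.mk_surjective y
  obtain ⟨r, hr⟩ := Ideal.Quotient.mk_surjective (AdicCompletion.evalOneₐ I y)
  obtain ⟨s, rfl⟩ := hφ r
  refine ⟨algebraMap S _ s, ?_⟩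
  rw [RingHom.comp_apply, Ideal.Quotient.eq, hmap, ← AdicCompletion.ker_evalOneₐ_eq_map I hIfg,
    RingHom.mem_ker, ← RingHom.comp_apply, hF]
  simp [← hr]

/-- The adic completion of a noetherian ring is noetherian: it is a quotient of a ring of power
series in finitely many variables. -/
theorem AdicCompletion.isNoetherianRing_self {R : Type*} [CommRing R] [IsNoetherianRing R]
    (I : Ideal R) : IsNoetherianRing (AdicCompletion I R) := by
  obtain ⟨t, ht⟩ := IsNoetherian.noetherian I
  have : IsNoetherianRing (AdicCompletion (MvPolynomial.idealOfVars t R) (MvPolynomial t R)) :=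
    isNoetherianRing_of_ringEquiv _ (MvPowerSeries.toAdicCompletionAlgEquiv t R).toRingEquiv
  refine isNoetherianRing_of_map_eq (MvPolynomial.idealOfVars_fg t R)
    (MvPolynomial.eval Subtype.val) (fun r ↦ ⟨MvPolynomial.C r, by simp⟩) ?_
  rw [MvPolynomial.idealOfVars, Ideal.map_span, ← Set.range_comp, ← ht]
  congr 1
  ext x
  simp

/-- The completion map is surjective modulo any power of a finitely generated ideal. -/
theorem AdicCompletion.exists_sub_mem_map_pow {R : Type*} [CommRing R] {I : Ideal R} (hI : I.FG)
    (k : ℕ) (b : AdicCompletion I R) :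
    ∃ r : R, b - algebraMap R (AdicCompletion I R) r ∈
      (I ^ k).map (algebraMap R (AdicCompletion I R)) := by
  obtain ⟨r, hr⟩ := Submodule.mkQ_surjective _ (AdicCompletion.eval I R k b)
  refine ⟨r, ?_⟩
  suffices b - algebraMap R (AdicCompletion I R) r ∈
      I ^ k • (⊤ : Submodule R (AdicCompletion I R)) by
    rwa [Ideal.smul_top_eq_map] at this
  rw [AdicCompletion.pow_smul_top_eq_ker_eval hI, LinearMap.mem_ker, map_sub, ← hr]
  exact sub_self _

end AdicCompletion

section ProjectiveDimension

open CategoryTheory Function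

universe u

/-- `Module.HasPD A n M` says that `M` has projective dimension at most `n` over `A`. -/
def Module.HasPD (A : Type u) [Ring A] (n : ℕ) (M : Type u) [AddCommGroup M] [Module A M] : Prop :=
  HasProjectiveDimensionLE (ModuleCat.of A M) n

namespace Module.HasPD

variable {A : Type u} [Ring A] {M N P : Type u} [AddCommGroup M] [Module A M]
  [AddCommGroup N] [Module A N] [AddCommGroup P] [Module A P] {n : ℕ}

theorem zero_iff : HasPD A 0 M ↔ Module.Projective A M :=
  (projective_iff_hasProjectiveDimensionLE_zero (X := ModuleCat.of A M)).symm.trans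
    (IsProjective.iff_projective (R := A) M).symm

theorem of_linearEquiv (e : M ≃ₗ[A] N) (h : HasPD A n M) : HasPD A n N :=
  have : HasProjectiveDimensionLE (ModuleCat.of A M) n := h
  ModuleCat.hasProjectiveDimensionLE_of_linearEquiv (M := ModuleCat.of A M)
    (N := ModuleCat.of A N) e n

variable {f : M →ₗ[A] N} {g : N →ₗ[A] P}

theorem shortExact_of_exact (h : Exact f g) (hf : Function.Injective f) (hg : Surjective g) :
    (ShortComplex.mk (ModuleCat.ofHom f) (ModuleCat.ofHom g) (by
      ext x; exact h.apply_apply_eq_zero x)).ShortExact :=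
  ModuleCat.shortComplex_shortExact _ h hf hg

theorem of_exact (h : Exact f g) (hf : Function.Injective f) (hg : Surjective g)
    (h₁ : HasPD A n M) (h₃ : HasPD A n P) : HasPD A n N :=
  (shortExact_of_exact h hf hg).hasProjectiveDimensionLT_X₂ _ h₁ h₃

theorem succ_iff_of_exact [Module.Projective A N] (h : Exact f g) (hf : Function.Injective f)
    (hg : Surjective g) : HasPD A (n + 1) P ↔ HasPD A n M :=
  (shortExact_of_exact h hf hg).hasProjectiveDimensionLT_X₃_iff n
    ((IsProjective.iff_projective (R := A) N).1 ‹_›)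

theorem succ_iff_ker [Module.Projective A N] (hg : Surjective g) :
    HasPD A (n + 1) P ↔ HasPD A n (LinearMap.ker g) :=
  succ_iff_of_exact (LinearMap.exact_subtype_ker_map g) (Submodule.injective_subtype _) hg

theorem exists_exact (h : HasPD A (n + 1) M) :
    ∃ (K F : Type u) (_ : AddCommGroup K) (_ : Module A K) (_ : AddCommGroup F) (_ : Module A F)
      (_ : Module.Projective A F) (f : K →ₗ[A] F) (g : F →ₗ[A] M),
      Exact f g ∧ Function.Injective f ∧ Surjective g ∧ HasPD A n K :=
  have hf := Finsupp.linearCombination_id_surjective A M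
  ⟨_, M →₀ A, _, _, _, _, inferInstance, _, _, LinearMap.exact_subtype_ker_map _,
    Submodule.injective_subtype _, hf, (succ_iff_ker hf).1 h⟩

end Module.HasPD

theorem projDimLE_iff_hasPD {A : Type} [Ring A] {n : ℕ} {M : ModuleCat.{0} A} :
    ProjDimLE A n M ↔ Module.HasPD A n M := by
  constructor
  · intro h
    induction h with
    | proj M h => exact Module.HasPD.zero_iff.2 h
    | step n M P hP f hf h ih => exact (Module.HasPD.succ_iff_ker hf).2 ih
  · intro h
    induction n generalizing M with
    | zero => exact .proj _ (Module.HasPD.zero_iff.1 h)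
    | succ n ih =>
      have hf := Finsupp.linearCombination_id_surjective A M
      exact .step n M (ModuleCat.of A (M →₀ A)) (inferInstanceAs (Module.Projective A (M →₀ A)))
        _ hf (ih ((Module.HasPD.succ_iff_ker hf).1 h))

end ProjectiveDimension

section BaseChange

open TensorProduct Function

universe u

variable (R : Type u) [CommRing R] (B : Type u) [CommRing B] [Algebra R B]
  (Λ : Type u) [Ring Λ] [Algebra R Λ]
  {M : Type u} [AddCommGroup M] [Module Λ M] [Module R M] [IsScalarTower R Λ M]
  {N : Type u} [AddCommGroup N] [Module Λ N] [Module R N] [IsScalarTower R Λ N]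
  {P : Type u} [AddCommGroup P] [Module Λ P] [Module R P] [IsScalarTower R Λ P]

variable (M) in
/-- The action of `B ⊗[R] Λ` on `B ⊗[R] M` for a `Λ`-module `M`. -/
noncomputable def Algebra.TensorProduct.tensorLsmul :
    B ⊗[R] Λ →ₐ[B] Module.End B (B ⊗[R] M) :=
  Algebra.TensorProduct.lift (Algebra.ofId B _)
    ((Module.End.baseChangeHom R B M).comp (Algebra.lsmul R R M))
    fun x y ↦
      show Commute (Algebra.ofId B _ x) (Module.End.baseChangeHom R B M (Algebra.lsmul R R M y)) from
      Algebra.commutes x _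

/-- The `B ⊗[R] Λ`-module structure on `B ⊗[R] M` for a `Λ`-module `M`. -/
noncomputable abbrev TensorProduct.tensorModule : Module (B ⊗[R] Λ) (B ⊗[R] M) :=
  Module.compHom _ (Algebra.TensorProduct.tensorLsmul R B Λ M).toRingHom

attribute [local instance] TensorProduct.tensorModule

variable {R B Λ}

theorem TensorProduct.tensor_smul_tmul (b b' : B) (a : Λ) (m : M) :
    (b ⊗ₜ[R] a) • (b' ⊗ₜ[R] m) = (b * b') ⊗ₜ[R] (a • m) := by
  change Algebra.TensorProduct.tensorLsmul R B Λ M (b ⊗ₜ[R] a) (b' ⊗ₜ[R] m) = _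
  change b • (b' ⊗ₜ[R] (a • m)) = _
  rw [smul_tmul', smul_eq_mul]

/-- An additive map commuting with the action of pure tensors on pure tensors is
`B ⊗[R] Λ`-linear. -/
theorem TensorProduct.map_tensor_smul {X : Type*} [AddCommGroup X] [Module (B ⊗[R] Λ) X]
    (f : B ⊗[R] M →+ X) (hf : ∀ (b b' : B) (a : Λ) (m : M),
      f ((b * b') ⊗ₜ[R] (a • m)) = (b ⊗ₜ[R] a) • f (b' ⊗ₜ[R] m))
    (a : B ⊗[R] Λ) (x : B ⊗[R] M) : f (a • x) = a • f x := by
  induction a with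
  | zero => simp
  | add a a' h h' => rw [add_smul, add_smul, map_add, h, h']
  | tmul b a =>
    induction x with
    | zero => simp
    | add x x' h h' => rw [smul_add, map_add, map_add, smul_add, h, h']
    | tmul b' m => rw [TensorProduct.tensor_smul_tmul, hf]

variable (R B) in
/-- The `B ⊗[R] Λ`-linear map `B ⊗[R] M → B ⊗[R] N` induced by a `Λ`-linear map `M → N`. -/
noncomputable def LinearMap.tensorMap (f : M →ₗ[Λ] N) : B ⊗[R] M →ₗ[B ⊗[R] Λ] B ⊗[R] N where
  __ := (f.restrictScalars R).lTensor B
  map_smul' := TensorProduct.map_tensor_smul ((f.restrictScalars R).lTensor B).toAddMonoidHom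
    fun b b' a m ↦ by simp [TensorProduct.tensor_smul_tmul]

theorem LinearMap.coe_tensorMap (f : M →ₗ[Λ] N) :
    ⇑(f.tensorMap R B) = (f.restrictScalars R).lTensor B := rfl

theorem Module.Projective.tensor [Module.Projective Λ M] :
    Module.Projective (B ⊗[R] Λ) (B ⊗[R] M) := by
  have hfree : Module.Projective (B ⊗[R] Λ) (B ⊗[R] (M →₀ Λ)) := by
    classical
    let e := TensorProduct.finsuppRight R R B Λ M
    refine Module.Projective.of_equiv' (M := M →₀ B ⊗[R] Λ) (LinearEquiv.symm
      (AddEquiv.toLinearEquiv e.toAddEquiv (TensorProduct.map_tensor_smul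
        e.toAddEquiv.toAddMonoidHom fun b b' a m ↦ ?_)))
    ext i
    simp [e, TensorProduct.finsuppRight_apply_tmul_apply]
  obtain ⟨s, hs⟩ := Module.projective_def'.1 ‹Module.Projective Λ M›
  refine .of_split (s.tensorMap R B)
    ((Finsupp.linearCombination Λ (id : M → M)).tensorMap R B) (LinearMap.ext fun x ↦ ?_)
  simp only [LinearMap.comp_apply, LinearMap.coe_tensorMap, ← LinearMap.lTensor_comp_apply,
    ← LinearMap.restrictScalars_comp, hs]
  exact LinearMap.lTensor_id_apply B M x

theorem Module.HasPD.tensor_succ_iff [Module.Flat R B] {n : ℕ} [Module.Projective Λ N]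
    {f : M →ₗ[Λ] N} {g : N →ₗ[Λ] P} (h : Exact f g) (hf : Function.Injective f) (hg : Surjective g) :
    Module.HasPD (B ⊗[R] Λ) (n + 1) (B ⊗[R] P) ↔ Module.HasPD (B ⊗[R] Λ) n (B ⊗[R] M) :=
  have : Module.Projective (B ⊗[R] Λ) (B ⊗[R] N) := Module.Projective.tensor
  Module.HasPD.succ_iff_of_exact (f := f.tensorMap R B) (g := g.tensorMap R B)
    (lTensor_exact (f := f.restrictScalars R) (g := g.restrictScalars R) B h hg)
    (Module.Flat.lTensor_preserves_injective_linearMap (f.restrictScalars R) hf)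
    (LinearMap.lTensor_surjective B (g := g.restrictScalars R) hg)

theorem Module.HasPD.tensor [Module.Flat R B] {n : ℕ} (h : Module.HasPD Λ n M) :
    Module.HasPD (B ⊗[R] Λ) n (B ⊗[R] M) := by
  induction n generalizing M with
  | zero =>
    have := Module.HasPD.zero_iff.1 h
    exact Module.HasPD.zero_iff.2 Module.Projective.tensor
  | succ n ih =>
    obtain ⟨K, F, _, _, _, _, _, f, g, hfg, hf, hg, hK⟩ := h.exists_exact
    let := Module.compHom K (algebraMap R Λ)
    let := Module.compHom F (algebraMap R Λ)
    have : IsScalarTower R Λ K := .of_compHom R Λ K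
    have : IsScalarTower R Λ F := .of_compHom R Λ F
    exact (Module.HasPD.tensor_succ_iff hfg hf hg).2 (ih hK)

/-- If `R → B` is surjective modulo an ideal `J` of `R`, then the projective dimension over
`B ⊗[R] Λ` of a module killed by `J` is bounded by its projective dimension over `Λ`. -/
theorem Module.HasPD.of_smul_eq_zero [Module.Flat R B] [Module (B ⊗[R] Λ) M]
    (hM : ∀ (a : Λ) (m : M), ((1 : B) ⊗ₜ[R] a) • m = a • m) (J : Ideal R)
    (hJ : ∀ b : B, ∃ r : R, b - algebraMap R B r ∈ J.map (algebraMap R B))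
    (hJM : ∀ r ∈ J, ∀ m : M, r • m = 0) {n : ℕ} (h : Module.HasPD Λ n M) :
    Module.HasPD (B ⊗[R] Λ) n M := by
  let ε : B ⊗[R] M →+ M := TensorProduct.liftAddHom
    ((smulAddHom (B ⊗[R] Λ) M).comp
      (Algebra.TensorProduct.includeLeftRingHom : B →+* B ⊗[R] Λ).toAddMonoidHom) fun r b m ↦ by
        change ((r • b) ⊗ₜ[R] (1 : Λ)) • m = (b ⊗ₜ[R] (1 : Λ)) • r • m
        rw [← algebraMap_smul Λ r m, ← hM, smul_smul, Algebra.TensorProduct.tmul_mul_tmul,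
          mul_one, one_mul, Algebra.algebraMap_eq_smul_one, smul_tmul]
  have hε (b : B) (m : M) : ε (b ⊗ₜ m) = (b ⊗ₜ[R] (1 : Λ)) • m := rfl
  have hε' (a : B ⊗[R] Λ) (x : B ⊗[R] M) : ε (a • x) = a • ε x := by
    refine TensorProduct.map_tensor_smul ε (fun b b' a m ↦ ?_) a x
    rw [hε, hε, ← hM, smul_smul, smul_smul]
    simp
  have hz (b : B) (hb : b ∈ J.map (algebraMap R B)) (m : M) : b ⊗ₜ[R] m = 0 := by
    induction hb using Submodule.span_induction with
    | mem x hx =>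
      obtain ⟨r, hr, rfl⟩ := hx
      rw [Algebra.algebraMap_eq_smul_one, smul_tmul, hJM r hr, tmul_zero]
    | zero => exact zero_tmul _ _
    | add x y _ _ hx hy => rw [add_tmul, hx, hy, add_zero]
    | smul c x _ hx => rw [← smul_tmul', hx, smul_zero]
  have hs (x : B ⊗[R] M) : ∃ m : M, x = 1 ⊗ₜ m := by
    induction x with
    | zero => exact ⟨0, (tmul_zero _ _).symm⟩
    | add x y hx hy =>
      obtain ⟨m, rfl⟩ := hx
      obtain ⟨m', rfl⟩ := hy
      exact ⟨m + m', (tmul_add _ _ _).symm⟩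
    | tmul b m =>
      obtain ⟨r, hr⟩ := hJ b
      refine ⟨r • m, sub_eq_zero.1 ?_⟩
      rw [← smul_tmul, ← sub_tmul, ← Algebra.algebraMap_eq_smul_one, hz _ hr]
  have h1 (m : M) : ε (1 ⊗ₜ m) = m := by
    rw [hε, ← Algebra.TensorProduct.one_def, one_smul]
  refine h.tensor.of_linearEquiv (LinearEquiv.ofBijective ⟨ε.toAddHom, hε'⟩ ⟨fun x y hxy ↦ ?_,
    fun m ↦ ⟨1 ⊗ₜ m, h1 m⟩⟩)
  obtain ⟨m, rfl⟩ := hs x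
  obtain ⟨m', rfl⟩ := hs y
  have hxy : ε (1 ⊗ₜ m) = ε (1 ⊗ₜ m') := hxy
  rw [h1, h1] at hxy
  rw [hxy]

end BaseChange

section Regular

open Function

universe u

variable {S : Type u} [CommRing S] [IsNoetherianRing S] {A : Type u} [Ring A] [Algebra S A]
  [Module.Finite S A]

/-- If the map `K → F × K`, `k ↦ (φ k, x k)` is injective with `F` projective and `x` in the
Jacobson radical, then the projective dimension of `K` is at most that of its cokernel. -/
theorem Module.HasPD.of_exact_prod_smul {x : S} (hx : x ∈ Ideal.jacobson (⊥ : Ideal S)) {n : ℕ}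
    {K F Z : Type u} [AddCommGroup K] [Module A K] [Module S K] [IsScalarTower S A K]
    [AddCommGroup F] [Module A F] [AddCommGroup Z] [Module A Z]
    [Module.Finite A K] [Module.Projective A F] (φ : K →ₗ[A] F) (g : F × K →ₗ[A] Z)
    (hinj : Function.Injective (φ.prod (x • LinearMap.id)))
    (hex : Exact (φ.prod (x • LinearMap.id)) g) (hg : Surjective g) (hZ : HasPD A n Z) :
    HasPD A n K := by
  have : IsNoetherianRing A := IsNoetherianRing.of_finite S A
  induction n generalizing K F Z with
  | zero =>
    have := zero_iff.1 hZ
    obtain ⟨l, hl⟩ := Module.projective_lifting_property g LinearMap.id hg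
    have hsplit := hex.split_tfae'.out 0 1
    obtain ⟨-, r, hr⟩ := hsplit.1 ⟨hinj, l, hl⟩
    have hr (k : K) : r (φ k, x • k) = k := LinearMap.congr_fun hr k
    have : Module.Finite S K := Module.Finite.trans A K
    let u : K →ₗ[A] K := r ∘ₗ LinearMap.inl A F K ∘ₗ φ
    have hu (k : K) : k = u k + x • (r ∘ₗ LinearMap.inr A F K) k := by
      conv_lhs => rw [← hr k]
      rw [← LinearMap.map_smul_of_tower]
      change _ = r (φ k, 0) + r (0, x • k)
      rw [← map_add, Prod.mk_add_mk, add_zero, zero_add]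
    have hsurj : Surjective u := by
      have : (⊤ : Submodule S K) ≤ LinearMap.range (u.restrictScalars S) := by
        refine Submodule.le_of_le_smul_of_le_jacobson_bot (I := Ideal.span {x})
          (Module.Finite.fg_top) ((Ideal.span_singleton_le_iff_mem _).2 hx) fun k _ ↦ ?_
        rw [hu k]
        exact Submodule.add_mem_sup ⟨k, rfl⟩
          (Submodule.smul_mem_smul (Ideal.mem_span_singleton_self x) trivial)
      exact fun k ↦ this (trivial : k ∈ ⊤)
    let e := LinearEquiv.ofBijective u
      ⟨IsNoetherian.injective_of_surjective_endomorphism u hsurj, hsurj⟩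
    refine zero_iff.2 (.of_split φ (e.symm.toLinearMap ∘ₗ r ∘ₗ LinearMap.inl A F K) ?_)
    ext k
    exact e.symm_apply_apply k
  | succ n ih =>
    obtain ⟨m, π, hπ⟩ := Module.Finite.exists_fin' A K
    let q : F × (Fin m → A) →ₗ[A] Z := g ∘ₗ (LinearMap.id.prodMap π)
    have hq : Surjective q := hg.comp (surjective_id.prodMap hπ)
    have hZ' := (succ_iff_ker hq).1 hZ
    have hx0 (k : K) : g (φ k, x • k) = 0 := hex.apply_apply_eq_zero k
    let K' := LinearMap.ker π
    let w : (Fin m → A) × K' →ₗ[A] F × (Fin m → A) :=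
      ((φ ∘ₗ π).prod (x • LinearMap.id)).coprod (LinearMap.inr A F _ ∘ₗ K'.subtype)
    have hw (a : Fin m → A) (k : K') : w (a, k) = (φ (π a), x • a + k) := by simp [w]
    let g' : (Fin m → A) × K' →ₗ[A] LinearMap.ker q := w.codRestrict _ fun ⟨a, k⟩ ↦ by
      have hk : π k = 0 := k.2
      simpa [hw, q, hk] using hx0 (π a)
    have hg'0 (a : Fin m → A) (k : K') : g' (a, k) = 0 ↔ φ (π a) = 0 ∧ x • a + k = 0 := by
      rw [← Subtype.coe_inj]
      change w (a, k) = 0 ↔ _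
      rw [hw, Prod.mk_eq_zero]
    refine (succ_iff_ker hπ).2 (ih (-K'.subtype) g' ?_ ?_ ?_ hZ')
    · intro k k' h
      exact Subtype.ext (neg_injective congr(($h).1))
    · rintro ⟨a, k⟩
      rw [hg'0]
      constructor
      · rintro ⟨h1, h2⟩
        have h3 : x • π a = 0 := by
          have hk : π k = 0 := k.2
          simpa [hk] using congr(π $h2)
        have h4 : π a = 0 := hinj (by simp [h1, h3])
        refine ⟨⟨-a, by simpa [K'] using h4⟩, Prod.ext (neg_neg a) (Subtype.ext ?_)⟩
        simpa using (eq_neg_of_add_eq_zero_right h2).symm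
      · rintro ⟨k', h⟩
        obtain ⟨rfl, rfl⟩ := Prod.mk.inj h
        have hk : π k' = 0 := k'.2
        simp [hk]
    · rintro ⟨⟨y, a⟩, hya⟩
      obtain ⟨k, hk⟩ := (hex (y, π a)).1 hya
      obtain ⟨b, rfl⟩ := hπ k
      obtain ⟨h1, h2⟩ := Prod.mk.inj hk
      refine ⟨(b, ⟨a - x • b, ?_⟩), Subtype.ext ?_⟩
      · simpa [sub_eq_zero] using h2.symm
      · change w _ = _
        rw [hw]
        exact Prod.ext h1 (add_sub_cancel _ _)

theorem Module.HasPD.of_isSMulRegular {x : S} (hx : x ∈ Ideal.jacobson (⊥ : Ideal S)) {n : ℕ}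
    {M N : Type u} [AddCommGroup M] [Module A M] [Module S M] [IsScalarTower S A M]
    [AddCommGroup N] [Module A N] [Module.Finite A M] (hreg : IsSMulRegular M x)
    (g : M →ₗ[A] N) (hex : ∀ m, g m = 0 ↔ ∃ m', x • m' = m) (hg : Surjective g)
    (h : HasPD A n N) : HasPD A n M := by
  refine of_exact_prod_smul hx (0 : M →ₗ[A] PUnit.{u + 1}) (g ∘ₗ LinearMap.snd A _ M) ?_ ?_ ?_ h
  · exact fun m m' hm ↦ hreg congr(($hm).2)
  · exact fun ⟨_, m⟩ ↦ (hex m).trans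
      ⟨fun ⟨m', h⟩ ↦ ⟨m', Prod.ext rfl h⟩, fun ⟨m', h⟩ ↦ ⟨m', congr(($h).2)⟩⟩
  · exact hg.comp Prod.snd_surjective

end Regular

section Devissage

universe u

variable {S : Type u} [CommRing S] [IsNoetherianRing S] {A : Type u} [Ring A] [Algebra S A]
  [Module.Finite S A]

variable (A) in
/-- All finitely generated modules whose support lies in the zero locus of `J` have projective
dimension at most `n`. -/
def Module.HasPDOn (n : ℕ) (J : Ideal S) : Prop :=
  ∀ (M : Type u) [AddCommGroup M] [Module A M] [Module S M] [IsScalarTower S A M]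
    [Module.Finite A M], J ≤ (Module.annihilator S M).radical → Module.HasPD A n M

theorem Module.HasPDOn.of_sup_span_singleton {n : ℕ} {J : Ideal S} {x : S}
    (hx : x ∈ Ideal.jacobson (⊥ : Ideal S)) (h : HasPDOn A n (Ideal.span {x} ⊔ J)) :
    HasPDOn A n J := by
  intro M _ _ _ _ _ hJ
  have : IsNoetherianRing A := IsNoetherianRing.of_finite S A
  let f : Module.End A M := x • LinearMap.id
  have hf (k : ℕ) (m : M) : (f ^ k) m = x ^ k • m := by
    induction k with
    | zero => simp
    | succ k ih => rw [pow_succ', Module.End.mul_apply, ih, pow_succ', mul_smul]; rfl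
  obtain ⟨k, hk⟩ := monotone_stabilizes_iff_noetherian.2
    (inferInstance : IsNoetherian A M) f.iterateKer
  let T := LinearMap.ker (f ^ k)
  have hT (m : M) : m ∈ T ↔ x ^ k • m = 0 := by rw [← hf]; rfl
  have hT' (m : M) (hm : x • m ∈ T) : m ∈ T := by
    have h1 : T = LinearMap.ker (f ^ (k + 1)) := hk (k + 1) k.le_succ
    rw [h1, LinearMap.mem_ker, hf, pow_succ, mul_smul]
    exact (hT _).1 hm
  have key (N : Type u) [AddCommGroup N] [Module A N] [Module S N] [IsScalarTower S A N]
      [Module.Finite A N] (hN : Module.annihilator S M ≤ Module.annihilator S N) (i : ℕ)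
      (hi : ∀ m : N, x ^ i • m = 0) : HasPD A n N :=
    h N (sup_le ((Ideal.span_singleton_le_iff_mem _).2 ⟨i, Module.mem_annihilator.2 hi⟩)
      (hJ.trans (Ideal.radical_mono hN)))
  let q : (M ⧸ T) →ₗ[A] (M ⧸ T) := x • LinearMap.id
  refine HasPD.of_exact (LinearMap.exact_subtype_mkQ T) (Submodule.injective_subtype _)
    (Submodule.mkQ_surjective _) (key T ?_ k ?_) (HasPD.of_isSMulRegular hx ?_
      (LinearMap.range q).mkQ ?_ (Submodule.mkQ_surjective _)
      (key ((M ⧸ T) ⧸ LinearMap.range q) ?_ 1 ?_))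
  · exact (T.subtype.restrictScalars S).annihilator_le_of_injective (Submodule.injective_subtype _)
  · exact fun m ↦ Subtype.ext ((hT m).1 m.2)
  · rw [isSMulRegular_iff_right_eq_zero_of_smul]
    intro y hy
    obtain ⟨m, rfl⟩ := T.mkQ_surjective y
    rw [← LinearMap.map_smul_of_tower] at hy
    simp only [Submodule.mkQ_apply, Submodule.Quotient.mk_eq_zero] at hy ⊢
    exact hT' m hy
  · exact fun m ↦ (Submodule.Quotient.mk_eq_zero _).trans Iff.rfl
  · exact (((LinearMap.range q).mkQ ∘ₗ T.mkQ).restrictScalars S).annihilator_le_of_surjective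
      ((Submodule.mkQ_surjective _).comp (Submodule.mkQ_surjective _))
  · intro y
    obtain ⟨m, rfl⟩ := (LinearMap.range q).mkQ_surjective y
    rw [pow_one, ← LinearMap.map_smul_of_tower]
    exact (Submodule.Quotient.mk_eq_zero _).2 ⟨m, rfl⟩

theorem Module.HasPDOn.bot_of_le_jacobson {n : ℕ} {I : Ideal S}
    (hI : I ≤ Ideal.jacobson (⊥ : Ideal S)) (h : HasPDOn A n I) : HasPDOn A n (⊥ : Ideal S) := by
  classical
  obtain ⟨t, rfl⟩ := IsNoetherian.noetherian I
  induction t using Finset.induction_on with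
  | empty => simpa using h
  | insert x t _ ih =>
    rw [Finset.coe_insert, Submodule.span_insert] at hI h
    exact ih (le_sup_right.trans hI) (h.of_sup_span_singleton
      (hI (le_sup_left (α := Ideal S) (Ideal.mem_span_singleton_self x))))

/-- If every finitely generated module killed by a power of an ideal `I` contained in the Jacobson
radical has projective dimension at most `n`, then so does every finitely generated module. -/
theorem Module.HasPD.of_finite {n : ℕ} {I : Ideal S} (hI : I ≤ Ideal.jacobson (⊥ : Ideal S))
    (h : ∀ (M : Type u) [AddCommGroup M] [Module A M] [Module S M] [IsScalarTower S A M]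
      [Module.Finite A M] (k : ℕ), I ^ k ≤ Module.annihilator S M → HasPD A n M)
    (M : Type u) [AddCommGroup M] [Module A M] [Module.Finite A M] : HasPD A n M := by
  let := Module.compHom M (algebraMap S A)
  have : IsScalarTower S A M := .of_compHom S A M
  have h' : HasPDOn A n I := by
    intro M _ _ _ _ _ hM
    obtain ⟨k, hk⟩ := Ideal.exists_pow_le_of_le_radical_of_fg hM (IsNoetherian.noetherian I)
    exact h M k hk
  exact h'.bot_of_le_jacobson hI M bot_le

end Devissage

section Auslander

open CategoryTheory Limits Abelian

universe u

variable {A : Type u} [Ring A]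

/-- Baer's criterion in terms of `Ext`. -/
theorem ModuleCat.injective_of_ext_quotient_eq_zero (X : ModuleCat.{u} A)
    (h : ∀ (J : Submodule A A) (e : Ext (ModuleCat.of A (A ⧸ J)) X 1), e = 0) :
    Injective X := by
  refine (Module.injective_iff_injective_object A X).1 (Module.Baer.injective fun J g ↦ ?_)
  have hS := Module.HasPD.shortExact_of_exact (LinearMap.exact_subtype_mkQ J)
    (Submodule.injective_subtype _) J.mkQ_surjective
  obtain ⟨x, hx⟩ := Ext.contravariant_sequence_exact₁ hS X (Ext.mk₀ (ModuleCat.ofHom g))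
    (add_zero 1) (h J _)
  obtain ⟨g', rfl⟩ := (Ext.mk₀_bijective _ _).2 x
  rw [Ext.mk₀_comp_mk₀] at hx
  have hg := (Ext.mk₀_bijective _ _).1 hx
  exact ⟨g'.hom, fun x hx ↦ LinearMap.congr_fun (congrArg ModuleCat.Hom.hom hg) ⟨x, hx⟩⟩

theorem ModuleCat.hasInjectiveDimensionLT_of_ext_quotient_eq_zero (n : ℕ) (X : ModuleCat.{u} A)
    (h : ∀ (J : Submodule A A) (e : Ext (ModuleCat.of A (A ⧸ J)) X (n + 1)), e = 0) :
    HasInjectiveDimensionLT X (n + 1) := by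
  induction n generalizing X with
  | zero =>
    have := X.injective_of_ext_quotient_eq_zero h
    infer_instance
  | succ n ih =>
    let ⟨p⟩ := EnoughInjectives.presentation X
    have hS : (ShortComplex.mk _ _ (cokernel.condition p.f)).ShortExact :=
      { exact := ShortComplex.exact_cokernel p.f }
    refine (hS.hasInjectiveDimensionLT_X₃_iff n p.injective).1 (ih _ fun J e ↦ ?_)
    obtain ⟨x, rfl⟩ := Ext.covariant_sequence_exact₃ _ hS e rfl (h J _)
    rw [Ext.eq_zero_of_injective x, Ext.zero_comp]

/-- Auslander's lemma: the projective dimension of cyclic modules bounds that of all modules. -/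
theorem Module.HasPD.of_quotient {n : ℕ} (h : ∀ J : Submodule A A, HasPD A n (A ⧸ J))
    (M : Type u) [AddCommGroup M] [Module A M] : HasPD A n M :=
  hasProjectiveDimensionLT_of_enoughInjectives _ _ fun X ↦
    have := X.hasInjectiveDimensionLT_of_ext_quotient_eq_zero n fun J e ↦
      have : HasProjectiveDimensionLT (ModuleCat.of A (A ⧸ J)) (n + 1) := h J
      e.eq_zero_of_hasProjectiveDimensionLT (n + 1) le_rfl
    HasInjectiveDimensionLT.subsingleton X (n + 1) (n + 1) le_rfl _

end Auslander

open TensorProduct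

/-- Let `(R, 𝔪)` be a commutative noetherian local ring and `Λ` a module-finite
`R`-algebra.  Then the global dimension of `R̂ ⊗_R Λ`, where `R̂` is the `𝔪`-adic
completion, is at most the global dimension of `Λ`. -/
theorem statement13 (R : Type) [CommRing R] [IsNoetherianRing R] [IsLocalRing R]
    (Λ : Type) [Ring Λ] [Algebra R Λ] [Module.Finite R Λ] (n : ℕ)
    (h : ∀ M : ModuleCat.{0} Λ, ProjDimLE Λ n M) :
    ∀ N : ModuleCat.{0} (AdicCompletion (IsLocalRing.maximalIdeal R) R ⊗[R] Λ),
      ProjDimLE (AdicCompletion (IsLocalRing.maximalIdeal R) R ⊗[R] Λ) n N := by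
  let S := AdicCompletion (IsLocalRing.maximalIdeal R) R
  have : IsNoetherianRing S := AdicCompletion.isNoetherianRing_self _
  have : Module.Flat R S := AdicCompletion.flat_of_isNoetherian _
  refine fun N ↦ projDimLE_iff_hasPD.2 (Module.HasPD.of_quotient (fun J ↦ ?_) N)
  refine Module.HasPD.of_finite (S := S) (IsLocalRing.maximalIdeal_le_jacobson _)
    (fun M _ _ _ _ _ k hk ↦ ?_) _
  let : Module Λ M := Module.compHom M
    (Algebra.TensorProduct.includeRight : Λ →ₐ[R] S ⊗[R] Λ).toRingHom
  let : Module R M := Module.compHom M (algebraMap R Λ)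
  have : IsScalarTower R Λ M := .of_compHom R Λ M
  refine Module.HasPD.of_smul_eq_zero (fun _ _ ↦ rfl) (IsLocalRing.maximalIdeal R ^ k)
    (AdicCompletion.exists_sub_mem_map_pow (IsNoetherian.noetherian _) k) (fun r hr m ↦ ?_)
    (projDimLE_iff_hasPD.1 (h (ModuleCat.of Λ M)))
  have hr' : algebraMap R S r ∈ Module.annihilator S M := hk <| by
    rw [AdicCompletion.maximalIdeal_eq_map, ← Ideal.map_pow]
    exact Ideal.mem_map_of_mem _ hr
  rw [← Module.mem_annihilator.1 hr' m, ← algebraMap_smul (S ⊗[R] Λ) (algebraMap R S r) m]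
  change ((1 : S) ⊗ₜ[R] algebraMap R Λ r) • m = (algebraMap R S r ⊗ₜ[R] (1 : Λ)) • m
  rw [Algebra.algebraMap_eq_smul_one, Algebra.algebraMap_eq_smul_one, TensorProduct.smul_tmul]
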